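/- For every integer r ≥ 2, γ(r) = max{π(T̂_{2i}^r) : 1 ≤ i ≤ ⌊r/2⌋}; that is, the maximum Turán density among all r-uniform hypergraphs with exactly three edges is attained by (and equals the maximum over) the r-suspensions of expanded triangles. -/

import Mathlib

open Filter

/-- The degree of a vertex in a hypergraph given as a finite set of edges. -/
def hypDegree {V : Type*} [DecidableEq V] (F : Finset (Finset V)) (v : V) : ℕ :=
  (F.filter fun e => v ∈ e).card

/-- `H` contains a copy of `F`: a map injective on the vertex support of `F`
sending every edge of `F` to an edge of `H`. -/
def HasCopy {V W : Type*} [DecidableEq V] (H : Finset (Finset V))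
    (F : Finset (Finset W)) : Prop :=
  ∃ φ : W → V, Set.InjOn φ (⋃ e ∈ F, (e : Set W)) ∧ ∀ e ∈ F, e.image φ ∈ H

/-- `F` is isomorphic to `G` (as edge sets; isolated vertices are irrelevant). -/
def IsIsoTo {V W : Type*} [DecidableEq V] (F : Finset (Finset W))
    (G : Finset (Finset V)) : Prop :=
  ∃ φ : W → V, Set.InjOn φ (⋃ e ∈ F, (e : Set W)) ∧ F.image (fun e => e.image φ) = G

open scoped Classical in
/-- The Turán number `ex(n, F)`: the maximum number of edges of an `F`-free
`r`-uniform hypergraph on `n` vertices. -/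
noncomputable def exNum (r n : ℕ) {m : ℕ} (F : Finset (Finset (Fin m))) : ℕ :=
  ((Finset.univ : Finset (Finset (Finset (Fin n)))).filter fun H =>
    (∀ e ∈ H, e.card = r) ∧ ¬ HasCopy H F).sup Finset.card

/-- The Turán density `π(F) = lim_{n → ∞} ex(n,F) / C(n,r)` (the limit exists). -/
noncomputable def turanDensity (r : ℕ) {m : ℕ} (F : Finset (Finset (Fin m))) : ℝ :=
  limUnder atTop fun n : ℕ => (exNum r n F : ℝ) / (n.choose r : ℝ)

/-- `γ(r)`: the maximum Turán density of an `r`-uniform hypergraph with exactly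
three edges. -/
noncomputable def gammaT (r : ℕ) : ℝ :=
  sSup {x : ℝ | ∃ (m : ℕ) (F : Finset (Finset (Fin m))),
    (∀ e ∈ F, e.card = r) ∧ F.card = 3 ∧ turanDensity r F = x}

/-- The expanded triangle `T_{2k}` on `3k` vertices: three pairwise disjoint
`k`-sets `S 0, S 1, S 2`, with edges `S 0 ∪ S 1`, `S 1 ∪ S 2`, `S 2 ∪ S 0`. -/
def expTriangle (k : ℕ) : Finset (Finset (Fin (3 * k))) :=
  let S : ℕ → Finset (Fin (3 * k)) :=
    fun a => Finset.univ.filter fun v => a * k ≤ v.val ∧ v.val < (a + 1) * k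
  {S 0 ∪ S 1, S 1 ∪ S 2, S 2 ∪ S 0}

/-- The suspension of a hypergraph: add the same set of `t` new cone vertices
to every edge.  For an `s`-graph `F`, the `r`-suspension `F̂^r` is `suspend (r - s) F`. -/
def suspend {m : ℕ} (t : ℕ) (F : Finset (Finset (Fin m))) :
    Finset (Finset (Fin (m + t))) :=
  F.image fun e =>
    e.image (Fin.castAdd t) ∪ Finset.univ.filter fun v : Fin (m + t) => m ≤ v.val

theorem jensen_expect {ι : Type*} [Fintype ι] [Nonempty ι] (f : ι → ℝ) (hf : ∀ i, 0 ≤ f i)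
    (M : ℕ) :
    (Finset.expect Finset.univ f) ^ M ≤ Finset.expect Finset.univ (fun i => f i ^ M) := by
  have h := Real.pow_arith_mean_le_arith_mean_pow (Finset.univ : Finset ι)
    (fun _ => ((Fintype.card ι : ℝ))⁻¹) f (fun _ _ => by positivity) (by simp) (fun i _ => hf i) M
  rw [Fintype.expect_eq_sum_div_card, Fintype.expect_eq_sum_div_card, Finset.sum_div,
    Finset.sum_div]
  simpa only [div_eq_inv_mul] using h

theorem expect_cons {X : Type*} [Fintype X] (g : ℕ) (f : (Fin (g + 1) → X) → ℝ) :
    Finset.expect Finset.univ f =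
      Finset.expect Finset.univ (fun x : X =>
        Finset.expect Finset.univ (fun y : Fin g → X => f (Fin.cons x y))) := by
  rw [← Finset.expect_product', Finset.univ_product_univ]
  exact (Fintype.expect_equiv (Fin.consEquiv (fun _ => X)) _ _ (fun _ => rfl)).symm

theorem prod_cons {X : Type*} [Fintype X] (g : ℕ) (f : (Fin (g + 1) → X) → ℝ) :
    ∏ c, f c = ∏ y : Fin g → X, ∏ x : X, f (Fin.cons x y) := by
  rw [Finset.prod_comm, ← Finset.prod_product', Finset.univ_product_univ]
  exact (Fintype.prod_equiv (Fin.consEquiv (fun _ => X)) _ _ (fun _ => rfl)).symm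

theorem box_ineq {V : Type*} [Fintype V] [Nonempty V] (N : ℕ) :
    ∀ (g : ℕ) (f : (Fin g → V) → ℝ), (∀ x, 0 ≤ f x) →
      (Finset.expect Finset.univ f) ^ (N ^ g) ≤
        Finset.expect Finset.univ (fun Φ : Fin g → (Fin N → V) =>
          ∏ c : Fin g → Fin N, f (fun i => Φ i (c i)))
  | 0, f, hf => by
      rw [Fintype.expect_eq_sum_div_card, Fintype.expect_eq_sum_div_card]
      simp
      apply le_of_eq
      congr 1
      exact Subsingleton.elim _ _
  | g + 1, f, hf => by
      rw [expect_cons, expect_cons]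
      have key : ∀ x : Fin N → V,
          (Finset.expect Finset.univ (fun y : Fin g → V => ∏ j, f (Fin.cons (x j) y))) ^ (N ^ g) ≤
          Finset.expect Finset.univ (fun Y : Fin g → (Fin N → V) =>
            ∏ c : Fin (g + 1) → Fin N,
              f (fun i => (Fin.cons x Y : Fin (g + 1) → (Fin N → V)) i (c i))) := by
        intro x
        refine (box_ineq N g (fun y => ∏ j, f (Fin.cons (x j) y))
          (fun y => Finset.prod_nonneg fun j _ => hf _)).trans (le_of_eq ?_)
        refine Finset.expect_congr rfl fun Y _ => ?_
        rw [prod_cons]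
        refine Finset.prod_congr rfl fun c _ => Finset.prod_congr rfl fun j _ => ?_
        congr 1
        funext i
        refine Fin.cases ?_ (fun i => ?_) i <;> simp
      refine le_trans ?_ (Finset.expect_le_expect fun x _ => key x)
      refine le_trans ?_ (jensen_expect _ (fun x => Finset.expect_nonneg fun y _ =>
        Finset.prod_nonneg fun j _ => hf _) _)
      rw [pow_succ', pow_mul]
      refine pow_le_pow_left₀ (pow_nonneg (Finset.expect_nonneg fun _ _ =>
        Finset.expect_nonneg fun _ _ => hf _) _) ?_ _
      rw [Finset.expect_comm]
      rw [Finset.expect_comm (f := fun (x : Fin N → V) (y : Fin g → V) => ∏ j, f (Fin.cons (x j) y))]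
      refine (jensen_expect _ (fun y => Finset.expect_nonneg fun _ _ => hf _) _).trans
        (le_of_eq ?_)
      refine Finset.expect_congr rfl fun y _ => ?_
      rw [Finset.expect_pow]
      simp

theorem card_collide {P V : Type*} [Fintype P] [Fintype V] [DecidableEq P] [DecidableEq V]
    (p q : P) (hpq : p ≠ q) :
    (Finset.univ.filter fun Φ : P → V => Φ p = Φ q).card ≤
      Fintype.card V ^ (Fintype.card P - 1) := by
  have : Fintype.card ({x : P // x ≠ p} → V) = Fintype.card V ^ (Fintype.card P - 1) := by
    rw [Fintype.card_fun, Fintype.card_subtype_compl, Fintype.card_subtype_eq]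
  rw [← this, ← Finset.card_univ]
  refine Finset.card_le_card_of_injOn (fun Φ x => Φ x.1) (fun _ _ => Finset.mem_coe.2 (Finset.mem_univ _)) ?_
  intro Φ hΦ Ψ hΨ h
  simp at hΦ hΨ
  have h' : ∀ x, x ≠ p → Φ x = Ψ x := fun x hx => congrFun h ⟨x, hx⟩
  funext x
  by_cases hx : x = p
  · rw [hx, hΦ, hΨ]; exact h' q hpq.symm
  · exact h' x hx

theorem card_noninj {P V : Type*} [Fintype P] [Fintype V] [DecidableEq P] [DecidableEq V] :
    (Finset.univ.filter fun Φ : P → V => ¬ Function.Injective Φ).card ≤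
      Fintype.card P ^ 2 * Fintype.card V ^ (Fintype.card P - 1) := by
  have hsub : (Finset.univ.filter fun Φ : P → V => ¬ Function.Injective Φ) ⊆
      (Finset.univ.filter fun pq : P × P => pq.1 ≠ pq.2).biUnion
        (fun pq => Finset.univ.filter fun Φ : P → V => Φ pq.1 = Φ pq.2) := by
    intro Φ hΦ
    simp [Function.Injective] at hΦ ⊢
    obtain ⟨a, b, h, hne⟩ := hΦ
    exact ⟨a, b, hne, h⟩
  refine (Finset.card_le_card hsub).trans ((Finset.card_biUnion_le_card_mul _ _
    (Fintype.card V ^ (Fintype.card P - 1)) ?_).trans ?_)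
  · intro pq h
    exact card_collide _ _ (by simpa using h)
  · refine Nat.mul_le_mul_right _ ((Finset.card_le_univ _).trans ?_)
    rw [Fintype.card_prod, sq]

open scoped Classical in
theorem exists_box (k N : ℕ) (δ : ℝ) (hδ : 0 < δ) :
    ∃ n₀ : ℕ, ∀ n ≥ n₀, ∀ S : Finset (Fin k → Fin n), δ * (n : ℝ) ^ k ≤ (S.card : ℝ) →
      ∃ Φ : Fin k → Fin N → Fin n, Function.Injective (fun p : Fin k × Fin N => Φ p.1 p.2) ∧
        ∀ c : Fin k → Fin N, (fun i => Φ i (c i)) ∈ S := by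
  obtain ⟨n₀, hn₀⟩ := exists_nat_gt (((k * N : ℕ) : ℝ) ^ 2 / δ ^ (N ^ k))
  refine ⟨n₀ + 1, fun n hn S hS => ?_⟩
  by_contra hcon
  push Not at hcon
  have hnpos : 0 < n := by omega
  have hnR : (0 : ℝ) < n := by exact_mod_cast hnpos
  have : Nonempty (Fin n) := ⟨⟨0, hnpos⟩⟩
  by_cases hkN : k * N = 0
  · -- the degenerate case: no points at all
    obtain ⟨ψ, hψ⟩ : S.Nonempty := by
      rw [← Finset.card_pos]
      have : (0 : ℝ) < S.card := lt_of_lt_of_le (by positivity) hS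
      exact_mod_cast this
    have hemp : IsEmpty (Fin k × Fin N) := by
      rw [← Fintype.card_eq_zero_iff]; simpa using hkN
    obtain ⟨c, hc⟩ := hcon (fun i _ => ψ i) (fun a => (hemp.false a).elim)
    exact hc hψ
  have hbox := box_ineq (V := Fin n) N k (fun ψ => if ψ ∈ S then 1 else 0)
    (fun x => by split_ifs <;> norm_num)
  have hprod : ∀ Φ : Fin k → Fin N → Fin n,
      (∏ c : Fin k → Fin N, (if (fun i => Φ i (c i)) ∈ S then (1 : ℝ) else 0)) ≤
        if ¬ Function.Injective (Function.uncurry Φ) then 1 else 0 := by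
    intro Φ
    by_cases hinj : Function.Injective (Function.uncurry Φ)
    · obtain ⟨c, hc⟩ := hcon Φ hinj
      rw [Finset.prod_eq_zero (Finset.mem_univ c) (by simp [hc])]
      split_ifs <;> norm_num
    · rw [if_pos hinj]
      exact Finset.prod_le_one (fun _ _ => by split_ifs <;> norm_num)
        (fun _ _ => by split_ifs <;> norm_num)
  have h2 := hbox.trans (Finset.expect_le_expect fun Φ _ => hprod Φ)
  have hcount : ((Finset.univ.filter fun Φ : Fin k → Fin N → Fin n =>
      ¬ Function.Injective (Function.uncurry Φ)).card : ℝ) ≤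
        ((k * N : ℕ) : ℝ) ^ 2 * (n : ℝ) ^ (k * N - 1) := by
    have h := card_noninj (P := Fin k × Fin N) (V := Fin n)
    have he : (Finset.univ.filter fun Φ : Fin k → Fin N → Fin n =>
      ¬ Function.Injective (Function.uncurry Φ)).card =
        (Finset.univ.filter fun Φ : Fin k × Fin N → Fin n => ¬ Function.Injective Φ).card := by
      refine Finset.card_equiv (Equiv.curry _ _ _).symm ?_
      intro Φ
      simp [Equiv.curry]
    rw [he]
    simp only [Fintype.card_prod, Fintype.card_fin] at h
    exact_mod_cast h
  rw [Fintype.expect_eq_sum_div_card, Fintype.expect_eq_sum_div_card, Finset.sum_boole,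
    Finset.sum_boole] at h2
  have hcard : (Fintype.card (Fin k → Fin N → Fin n) : ℝ) = (n : ℝ) ^ (k * N) := by
    simp [← pow_mul, mul_comm]
  have hcard2 : (Fintype.card (Fin k → Fin n) : ℝ) = (n : ℝ) ^ k := by simp
  have hSS : (Finset.univ.filter fun ψ => ψ ∈ S) = S := by ext; simp
  rw [hcard, hcard2, hSS] at h2
  have h3 : δ ^ (N ^ k) ≤ ((k * N : ℕ) : ℝ) ^ 2 / n := by
    refine (pow_le_pow_left₀ hδ.le ((le_div_iff₀ (by positivity)).2 hS) _).trans (h2.trans ?_)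
    rw [div_le_div_iff₀ (by positivity) hnR]
    calc _ ≤ (((k * N : ℕ) : ℝ) ^ 2 * (n : ℝ) ^ (k * N - 1)) * n := by gcongr
      _ = ((k * N : ℕ) : ℝ) ^ 2 * ((n : ℝ) ^ (k * N - 1) * n) := by ring
      _ = _ := by rw [← pow_succ, Nat.sub_add_cancel (by omega)]
  rw [div_lt_iff₀ (by positivity)] at hn₀
  rw [le_div_iff₀ hnR] at h3
  have : (n₀ : ℝ) < n := by exact_mod_cast (by omega : n₀ < n)
  have h4 : (n₀ : ℝ) * δ ^ (N ^ k) < n * δ ^ (N ^ k) := by gcongr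
  linarith

theorem mul_exNum_le (r n : ℕ) {m : ℕ} (F : Finset (Finset (Fin m))) (a X : ℕ)
    (h : ∀ H : Finset (Finset (Fin n)), (∀ e ∈ H, e.card = r) → ¬ HasCopy H F →
      a * H.card ≤ X) : a * exNum r n F ≤ X := by
  classical
  unfold exNum
  rcases Finset.eq_empty_or_nonempty
    ((Finset.univ : Finset (Finset (Finset (Fin n)))).filter fun H =>
      (∀ e ∈ H, e.card = r) ∧ ¬ HasCopy H F) with h0 | h0
  · rw [h0]; simp
  · obtain ⟨H, hH, he⟩ := Finset.exists_mem_eq_sup _ h0 Finset.card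
    rw [he]
    simp only [Finset.mem_filter, Finset.mem_univ, true_and] at hH
    exact h H hH.1 hH.2

theorem card_le_exNum {r n m : ℕ} {F : Finset (Finset (Fin m))} {H : Finset (Finset (Fin n))}
    (hu : ∀ e ∈ H, e.card = r) (hf : ¬ HasCopy H F) : H.card ≤ exNum r n F := by
  classical
  unfold exNum
  exact Finset.le_sup (f := Finset.card) (by simp only [Finset.mem_filter, Finset.mem_univ, true_and]; exact ⟨hu, hf⟩)

theorem exNum_step (r n : ℕ) {m : ℕ} (F : Finset (Finset (Fin m))) :
    (n + 1 - r) * exNum r (n + 1) F ≤ (n + 1) * exNum r n F := by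
  classical
  refine mul_exNum_le _ _ _ _ _ fun H hu hf => ?_
  have h1 : ∀ v : Fin (n + 1), (H.filter fun h => v ∉ h).card ≤ exNum r n F := by
    intro v
    let K : Finset (Finset (Fin n)) := Finset.univ.filter fun e => e.image v.succAbove ∈ H
    have hKu : ∀ e ∈ K, e.card = r := by
      intro e he
      rw [← hu _ (Finset.mem_filter.1 he).2,
        Finset.card_image_of_injective _ Fin.succAbove_right_injective]
    have hKf : ¬ HasCopy K F := by
      rintro ⟨φ, hφ, hφe⟩
      refine hf ⟨fun w => v.succAbove (φ w), ?_, ?_⟩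
      · intro a ha b hb hab
        exact hφ ha hb (Fin.succAbove_right_injective hab)
      · intro e he
        have := (Finset.mem_filter.1 (hφe e he)).2
        rw [Finset.image_image] at this
        exact this
    refine le_trans ?_ (card_le_exNum hKu hKf)
    refine le_trans (Finset.card_le_card ?_)
      (Finset.card_image_le (s := K) (f := fun e => e.image v.succAbove))
    intro h hh
    obtain ⟨hH, hv⟩ := Finset.mem_filter.1 hh
    have heq : (Finset.univ.filter fun x => v.succAbove x ∈ h).image v.succAbove = h := by
      ext y
      simp only [Finset.mem_image, Finset.mem_filter, Finset.mem_univ, true_and]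
      constructor
      · rintro ⟨x, hx, rfl⟩; exact hx
      · intro hy
        obtain ⟨x, rfl⟩ := Fin.exists_succAbove_eq (x := y) (y := v) (by rintro rfl; exact hv hy)
        exact ⟨x, hy, rfl⟩
    refine Finset.mem_image.2 ⟨_, Finset.mem_filter.2 ⟨Finset.mem_univ _, ?_⟩, heq⟩
    rw [heq]; exact hH
  calc (n + 1 - r) * H.card = ∑ h ∈ H, (n + 1 - r) := by simp [mul_comm]
    _ = ∑ h ∈ H, (Finset.univ.filter fun v : Fin (n + 1) => v ∉ h).card := by
        refine Finset.sum_congr rfl fun h hh => ?_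
        rw [Finset.filter_not, Finset.card_sdiff_of_subset (Finset.filter_subset _ _)]
        simp [hu h hh]
    _ = ∑ v : Fin (n + 1), (H.filter fun h => v ∉ h).card :=
        Finset.sum_card_bipartiteAbove_eq_sum_card_bipartiteBelow (fun h v => v ∉ h)
    _ ≤ ∑ v : Fin (n + 1), exNum r n F := Finset.sum_le_sum fun v _ => h1 v
    _ = _ := by simp

theorem tendsto_turanDensity (r : ℕ) {m : ℕ} (F : Finset (Finset (Fin m))) :
    Tendsto (fun n : ℕ => (exNum r n F : ℝ) / (n.choose r : ℝ)) atTop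
      (nhds (turanDensity r F)) := by
  have hanti : Antitone (fun n : ℕ => (exNum r (n + r) F : ℝ) / ((n + r).choose r : ℝ)) := by
    refine antitone_nat_of_succ_le fun n => ?_
    have h1 := exNum_step r (n + r) F
    have h2 := Nat.choose_mul_succ_eq (n + r) r
    have e1 : n + r + 1 - r = n + 1 := by omega
    rw [e1] at h1 h2
    have hp1 : 0 < (n + r).choose r := Nat.choose_pos (by omega)
    have hp2 : 0 < (n + r + 1).choose r := Nat.choose_pos (by omega)
    rw [show n + 1 + r = n + r + 1 by ring]
    rw [div_le_div_iff₀ (by exact_mod_cast hp2) (by exact_mod_cast hp1)]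
    norm_cast
    refine Nat.le_of_mul_le_mul_left (c := (n + 1)) ?_ (by omega)
    calc (n + 1) * (exNum r (n + r + 1) F * (n + r).choose r)
        = ((n + 1) * exNum r (n + r + 1) F) * (n + r).choose r := by ring
      _ ≤ ((n + r + 1) * exNum r (n + r) F) * (n + r).choose r := Nat.mul_le_mul_right _ h1
      _ = exNum r (n + r) F * ((n + r).choose r * (n + r + 1)) := by ring
      _ = _ := by rw [h2]; ring
  have hb : BddBelow (Set.range (fun n : ℕ => (exNum r (n + r) F : ℝ) / ((n + r).choose r : ℝ))) :=
    ⟨0, by rintro _ ⟨n, rfl⟩; positivity⟩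
  have h := tendsto_atTop_ciInf hanti hb
  rw [tendsto_add_atTop_iff_nat (f := fun n : ℕ => (exNum r n F : ℝ) / (n.choose r : ℝ)) r] at h
  exact tendsto_nhds_limUnder ⟨_, h⟩

theorem count_maps {r n k : ℕ} (H : Finset (Finset (Fin n))) (hu : ∀ e ∈ H, e.card = r)
    (e : Finset (Fin k)) (he : e.card = r) :
    H.card * r.factorial * n ^ (k - r) ≤
      (Finset.univ.filter fun ψ : Fin k → Fin n => e.image ψ ∈ H).card := by
  classical
  let D := Σ h : H, (e ≃ h.1) × ({x // x ∉ e} → Fin n)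
  have hD : Fintype.card D = H.card * r.factorial * n ^ (k - r) := by
    rw [Fintype.card_sigma]
    have : ∀ h : H, Fintype.card ((e ≃ h.1) × ({x // x ∉ e} → Fin n)) =
        r.factorial * n ^ (k - r) := by
      intro h
      rw [Fintype.card_prod, Fintype.card_equiv (Finset.equivOfCardEq (he.trans (hu _ h.2).symm)),
        Fintype.card_fun, Fintype.card_subtype_compl]
      simp [he]
    rw [Finset.sum_congr rfl fun h _ => this h]
    simp [mul_assoc]
  rw [← hD, ← Finset.card_univ]
  have himg : ∀ d : D, e.image (fun v => if hv : v ∈ e then (d.2.1 ⟨v, hv⟩ : Fin n)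
      else d.2.2 ⟨v, hv⟩) = d.1.1 := by
    intro d
    ext y
    simp only [Finset.mem_image]
    constructor
    · rintro ⟨v, hv, rfl⟩
      simp [hv]
    · intro hy
      refine ⟨(d.2.1.symm ⟨y, hy⟩).1, (d.2.1.symm ⟨y, hy⟩).2, ?_⟩
      simp
  refine Finset.card_le_card_of_injOn (fun (d : D) v => if hv : v ∈ e then (d.2.1 ⟨v, hv⟩ : Fin n)
      else d.2.2 ⟨v, hv⟩) ?_ ?_
  · intro d _
    simp only [Finset.coe_filter, Finset.mem_univ, true_and, Set.mem_ofPred_eq]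
    rw [himg d]; exact d.1.2
  · intro d _ d' _ hdd
    have h1 := himg d
    have h2 := himg d'
    simp only at hdd
    rw [hdd, h2] at h1
    obtain ⟨⟨h, hh⟩, σ, τ⟩ := d
    obtain ⟨⟨h', hh'⟩, σ', τ'⟩ := d'
    simp only at h1
    subst h1
    congr 2
    · ext ⟨v, hv⟩
      have := congrFun hdd v
      simp only [hv, dif_pos] at this
      exact congrArg Fin.val this
    · funext ⟨v, hv⟩
      have := congrFun hdd v
      simpa only [hv, dif_neg, not_false_eq_true] using this

open scoped Classical in
/-- An `F`-free host has few maps `ψ` for which `ψ ∘ φ` is a homomorphism of `G`. -/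
theorem few_homs {r m g n k N : ℕ} (hr : 0 < r) {F : Finset (Finset (Fin m))} {G : Finset (Finset (Fin g))}
    (hFu : ∀ e ∈ F, e.card = r) (hGu : ∀ e ∈ G, e.card = r)
    (χ : Fin m → Fin g) (hχ : ∀ e ∈ F, e.image χ ∈ G)
    (H : Finset (Finset (Fin n))) (hHu : ∀ e ∈ H, e.card = r) (hN : N = m)
    (φ : Fin g → Fin k) (hφ : Set.InjOn φ (⋃ e ∈ G, (e : Set (Fin g))))
    (Φ : Fin k → Fin N → Fin n) (hinj : Function.Injective (fun p : Fin k × Fin N => Φ p.1 p.2))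
    (hΦ : ∀ c : Fin k → Fin N, ∀ e ∈ G, e.image (fun w => Φ (φ w) (c (φ w))) ∈ H) :
    HasCopy H F := by
  subst hN
  refine ⟨fun w => Φ (φ (χ w)) w, ?_, ?_⟩
  · intro a _ b _ hab
    have := hinj (a₁ := (φ (χ a), a)) (a₂ := (φ (χ b), b)) hab
    exact (Prod.ext_iff.1 this).2
  · intro e he
    obtain ⟨w0, hw0⟩ : e.Nonempty := by
      rw [← Finset.card_pos, hFu e he]; exact hr
    have hinjχ : Set.InjOn χ e := by
      rw [← Finset.card_image_iff, hGu _ (hχ e he), hFu e he]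
    have hinj2 : Set.InjOn (fun w => φ (χ w)) e := by
      intro a ha b hb hab
      refine hinjχ ha hb (hφ ?_ ?_ hab)
      · exact Set.mem_biUnion (hχ e he) (Finset.mem_coe.2 (Finset.mem_image_of_mem _ ha))
      · exact Set.mem_biUnion (hχ e he) (Finset.mem_coe.2 (Finset.mem_image_of_mem _ hb))
    have hne : Nonempty (Fin N) := ⟨w0⟩
    let c : Fin k → Fin N := Function.invFunOn (fun w => φ (χ w)) e
    have hc : ∀ w ∈ e, c (φ (χ w)) = w := fun w hw =>
      hinj2.leftInvOn_invFunOn hw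
    have := hΦ c _ (hχ e he)
    rw [Finset.image_image] at this
    convert this using 1
    refine Finset.image_congr fun w hw => ?_
    simp [hc w hw]

theorem exNum_le_real (r n : ℕ) {m : ℕ} (F : Finset (Finset (Fin m))) (X : ℝ) (hX : 0 ≤ X)
    (h : ∀ H : Finset (Finset (Fin n)), (∀ e ∈ H, e.card = r) → ¬ HasCopy H F →
      (H.card : ℝ) ≤ X) : (exNum r n F : ℝ) ≤ X := by
  have := mul_exNum_le r n F 1 ⌊X⌋₊ (fun H hu hf => by
    rw [one_mul]; exact Nat.le_floor (h H hu hf))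
  rw [one_mul] at this
  exact (Nat.le_floor_iff hX).1 this

open scoped Classical in
theorem exNum_hom_bound {r m g k : ℕ} (hr : 0 < r) (hk : r ≤ k)
    {F : Finset (Finset (Fin m))} {G : Finset (Finset (Fin g))}
    (hFu : ∀ e ∈ F, e.card = r) (hGu : ∀ e ∈ G, e.card = r)
    (χ : Fin m → Fin g) (hχ : ∀ e ∈ F, e.image χ ∈ G) (ε : ℝ) (hε : 0 < ε) :
    ∃ n₀ : ℕ, ∀ n ≥ n₀,
      (exNum r n F : ℝ) ≤ ((exNum r k G : ℝ) + ε) * (n : ℝ) ^ r / (r.factorial * k.choose r) := by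
  have hkpos : 0 < k := by omega
  have hC : (0 : ℝ) < k.choose r := by exact_mod_cast Nat.choose_pos hk
  have hkg : (0 : ℝ) < (k : ℝ) ^ g := by positivity
  have hfac : (0 : ℝ) < r.factorial := by exact_mod_cast r.factorial_pos
  set δ : ℝ := ε / (k.choose r * (k : ℝ) ^ g) with hδdef
  have hδ : 0 < δ := by positivity
  obtain ⟨n₀, hn₀⟩ := exists_box k m δ hδ
  refine ⟨n₀ + 1, fun n hn => exNum_le_real _ _ _ _ (by positivity) fun H hHu hHf => ?_⟩
  have hnR : (0 : ℝ) < n := by exact_mod_cast (by omega : 0 < n)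
  let I : Finset (Fin g → Fin k) :=
    Finset.univ.filter fun φ => Set.InjOn φ (⋃ e ∈ G, (e : Set (Fin g)))
  let S : (Fin g → Fin k) → Finset (Fin k → Fin n) := fun φ =>
    Finset.univ.filter fun ψ => ∀ e ∈ G, e.image (fun w => ψ (φ w)) ∈ H
  have hS : ∀ φ ∈ I, ((S φ).card : ℝ) ≤ δ * (n : ℝ) ^ k := by
    intro φ hφ
    by_contra hcon
    push Not at hcon
    obtain ⟨Φ, hΦi, hΦ⟩ := hn₀ n (by omega) (S φ) hcon.le
    refine hHf (few_homs hr hFu hGu χ hχ H hHu rfl φ (Finset.mem_filter.1 hφ).2 Φ hΦi ?_)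
    intro c
    exact (Finset.mem_filter.1 (hΦ c)).2
  let E : Finset (Finset (Fin k)) := Finset.powersetCard r Finset.univ
  have hEc : E.card = k.choose r := by simp [E]
  let HH : (Fin k → Fin n) → Finset (Finset (Fin k)) := fun ψ =>
    E.filter fun e => e.image ψ ∈ H
  have hpt : ∀ ψ, (HH ψ).card ≤ exNum r k G + k.choose r * (I.filter fun φ => ψ ∈ S φ).card := by
    intro ψ
    by_cases hc : HasCopy (HH ψ) G
    · obtain ⟨φ, hφ, hφe⟩ := hc
      have hmem : φ ∈ I.filter fun φ => ψ ∈ S φ := by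
        refine Finset.mem_filter.2 ⟨Finset.mem_filter.2 ⟨Finset.mem_univ _, hφ⟩,
          Finset.mem_filter.2 ⟨Finset.mem_univ _, fun e he => ?_⟩⟩
        have := (Finset.mem_filter.1 (hφe e he)).2
        rw [Finset.image_image] at this
        exact this
      have h1 : 1 ≤ (I.filter fun φ => ψ ∈ S φ).card := Finset.card_pos.2 ⟨φ, hmem⟩
      have h2 : (HH ψ).card ≤ k.choose r := hEc ▸ Finset.card_filter_le _ _
      nlinarith
    · have := card_le_exNum (H := HH ψ) (r := r)
        (fun e he => (Finset.mem_powersetCard.1 (Finset.mem_filter.1 he).1).2) hc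
      omega
  have hsum : k.choose r * (H.card * r.factorial * n ^ (k - r)) ≤
      n ^ k * exNum r k G + k.choose r * ∑ φ ∈ I, (S φ).card := by
    calc k.choose r * (H.card * r.factorial * n ^ (k - r))
        = ∑ e ∈ E, (H.card * r.factorial * n ^ (k - r)) := by simp [hEc]
      _ ≤ ∑ e ∈ E, (Finset.univ.filter fun ψ : Fin k → Fin n => e.image ψ ∈ H).card :=
          Finset.sum_le_sum fun e he => count_maps H hHu e (Finset.mem_powersetCard.1 he).2
      _ = ∑ ψ : Fin k → Fin n, (HH ψ).card := by
          have := Finset.sum_card_bipartiteAbove_eq_sum_card_bipartiteBelow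
            (s := E) (t := (Finset.univ : Finset (Fin k → Fin n))) (fun e ψ => e.image ψ ∈ H)
          refine Eq.trans (Finset.sum_congr rfl fun e _ => ?_)
            (this.trans (Finset.sum_congr rfl fun ψ _ => ?_))
          · congr 1
          · congr 1
      _ ≤ ∑ ψ : Fin k → Fin n,
            (exNum r k G + k.choose r * (I.filter fun φ => ψ ∈ S φ).card) :=
          Finset.sum_le_sum fun ψ _ => hpt ψ
      _ = n ^ k * exNum r k G + k.choose r * ∑ ψ, (I.filter fun φ => ψ ∈ S φ).card := by
          rw [Finset.sum_add_distrib, Finset.mul_sum]; simp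
      _ = _ := by
          congr 2
          have := Finset.sum_card_bipartiteAbove_eq_sum_card_bipartiteBelow
            (s := (Finset.univ : Finset (Fin k → Fin n))) (t := I) (fun ψ φ => ψ ∈ S φ)
          refine this.trans (Finset.sum_congr rfl fun φ _ => ?_)
          congr 1
          ext ψ
          simp [Finset.bipartiteBelow]
  have hsumR : (k.choose r : ℝ) * (H.card * r.factorial * (n : ℝ) ^ (k - r)) ≤
      (n : ℝ) ^ k * exNum r k G + k.choose r * ∑ φ ∈ I, ((S φ).card : ℝ) := by
    exact_mod_cast hsum
  have hI : (I.card : ℝ) ≤ (k : ℝ) ^ g := by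
    have : I.card ≤ k ^ g := (Finset.card_le_univ _).trans (by simp)
    exact_mod_cast this
  have h5 : ∑ φ ∈ I, ((S φ).card : ℝ) ≤ (k : ℝ) ^ g * (δ * (n : ℝ) ^ k) := by
    refine (Finset.sum_le_card_nsmul _ _ _ hS).trans ?_
    rw [nsmul_eq_mul]
    gcongr
  have h6 : (k.choose r : ℝ) * ((k : ℝ) ^ g * (δ * (n : ℝ) ^ k)) = ε * (n : ℝ) ^ k := by
    rw [hδdef]; field_simp
  have h7 : (n : ℝ) ^ k = (n : ℝ) ^ (k - r) * (n : ℝ) ^ r := by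
    rw [← pow_add]; congr 1; omega
  rw [le_div_iff₀ (by positivity)]
  have hp : (0 : ℝ) < (n : ℝ) ^ (k - r) := by positivity
  refine le_of_mul_le_mul_left ?_ hp
  calc (n : ℝ) ^ (k - r) * (H.card * (r.factorial * k.choose r))
      = (k.choose r : ℝ) * (H.card * r.factorial * (n : ℝ) ^ (k - r)) := by ring
    _ ≤ (n : ℝ) ^ k * exNum r k G + k.choose r * ((k : ℝ) ^ g * (δ * (n : ℝ) ^ k)) :=
        hsumR.trans (by gcongr)
    _ = (n : ℝ) ^ k * exNum r k G + ε * (n : ℝ) ^ k := by rw [h6]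
    _ = _ := by rw [h7]; ring

theorem turanDensity_le_of_hom {r m g : ℕ} (hr : 0 < r)
    {F : Finset (Finset (Fin m))} {G : Finset (Finset (Fin g))}
    (hFu : ∀ e ∈ F, e.card = r) (hGu : ∀ e ∈ G, e.card = r)
    (χ : Fin m → Fin g) (hχ : ∀ e ∈ F, e.image χ ∈ G) :
    turanDensity r F ≤ turanDensity r G := by
  have hfac : (0 : ℝ) < r.factorial := by exact_mod_cast r.factorial_pos
  -- the ratio `n ^ r / (r! * C(n, r))` tends to one
  have hratio : Tendsto (fun n : ℕ => ((n : ℝ) ^ r / r.factorial) / (n.choose r : ℝ)) atTop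
      (nhds 1) := by
    have h := (isEquivalent_choose r).symm
    rw [Asymptotics.isEquivalent_iff_tendsto_one] at h
    · exact h
    · filter_upwards [eventually_ge_atTop r] with n hn
      exact_mod_cast (Nat.choose_pos hn).ne'
  have hstep : ∀ k, r ≤ k → ∀ ε : ℝ, 0 < ε →
      turanDensity r F ≤ ((exNum r k G : ℝ) + ε) / k.choose r := by
    intro k hk ε hε
    obtain ⟨n₀, hn₀⟩ := exNum_hom_bound hr hk hFu hGu χ hχ ε hε
    have hC : (0 : ℝ) < k.choose r := by exact_mod_cast Nat.choose_pos hk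
    have hlim : Tendsto (fun n : ℕ => (((exNum r k G : ℝ) + ε) / k.choose r) *
        (((n : ℝ) ^ r / r.factorial) / (n.choose r : ℝ))) atTop
        (nhds (((exNum r k G : ℝ) + ε) / k.choose r)) := by
      simpa using hratio.const_mul (((exNum r k G : ℝ) + ε) / k.choose r)
    refine le_of_tendsto_of_tendsto (tendsto_turanDensity r F) hlim ?_
    filter_upwards [eventually_ge_atTop n₀] with n hn
    refine (div_le_div_of_nonneg_right (hn₀ n hn) (by positivity)).trans (le_of_eq ?_)
    field_simp
  have hstep2 : ∀ k, r ≤ k → turanDensity r F ≤ (exNum r k G : ℝ) / k.choose r := by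
    intro k hk
    have hC : (0 : ℝ) < k.choose r := by exact_mod_cast Nat.choose_pos hk
    rw [le_div_iff₀ hC]
    refine le_of_forall_pos_le_add fun ε hε => ?_
    exact (le_div_iff₀ hC).1 (hstep k hk ε hε)
  refine ge_of_tendsto (tendsto_turanDensity r G) ?_
  filter_upwards [eventually_ge_atTop r] with k hk
  exact hstep2 k hk

theorem extend_edge {W X : Type*} [DecidableEq W] [DecidableEq X] (A D : Finset W) (E : Finset X)
    (hc : A.card = E.card) (f : W → X) (hf : ∀ v ∈ A, v ∈ D → f v ∈ E)
    (hi : ∀ v ∈ A, v ∈ D → ∀ w ∈ A, w ∈ D → f v = f w → v = w) :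
    ∃ g : W → X, A.image g = E ∧ ∀ v ∈ A, v ∈ D → g v = f v := by
  have hαt : Fintype.card A = E.card := by simpa using hc
  obtain ⟨e, he⟩ := Set.MapsTo.exists_equiv_extend_of_card_eq (α := A) (t := E) hαt
    (s := {a | a.1 ∈ D}) (f := fun a => f a.1) (fun a ha => hf a.1 a.2 ha)
    (fun a ha b hb hab => Subtype.ext (hi a.1 a.2 ha b.1 b.2 hb hab))
  refine ⟨fun v => if h : v ∈ A then (e ⟨v, h⟩ : X) else f v, ?_, ?_⟩
  · ext y
    simp only [Finset.mem_image]
    constructor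
    · rintro ⟨v, hv, rfl⟩
      simp [hv]
    · intro hy
      refine ⟨(e.symm ⟨y, hy⟩).1, (e.symm ⟨y, hy⟩).2, ?_⟩
      simp
  · intro v hv hD
    simp only [hv, dif_pos]
    exact he ⟨v, hv⟩ hD

theorem glue {W X : Type*} [DecidableEq W] [DecidableEq X] (A B C D : Finset W)
    (EA EB EC : Finset X)
    (hA : A.card = EA.card) (hB : B.card = EB.card) (hC : C.card = EC.card)
    (hAB : ∀ v ∈ A, v ∈ B → v ∈ D) (hBC : ∀ v ∈ B, v ∈ C → v ∈ D) (hCA : ∀ v ∈ C, v ∈ A → v ∈ D)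
    (f : W → X) (hi : ∀ v ∈ D, ∀ w ∈ D, f v = f w → v = w)
    (hfA : ∀ v ∈ A, v ∈ D → f v ∈ EA) (hfB : ∀ v ∈ B, v ∈ D → f v ∈ EB)
    (hfC : ∀ v ∈ C, v ∈ D → f v ∈ EC) :
    ∃ χ : W → X, A.image χ = EA ∧ B.image χ = EB ∧ C.image χ = EC := by
  obtain ⟨a, ha, ha'⟩ := extend_edge A D EA hA f hfA (fun v _ hv w _ hw => hi v hv w hw)
  obtain ⟨b, hb, hb'⟩ := extend_edge B D EB hB f hfB (fun v _ hv w _ hw => hi v hv w hw)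
  obtain ⟨c, hc, hc'⟩ := extend_edge C D EC hC f hfC (fun v _ hv w _ hw => hi v hv w hw)
  refine ⟨fun v => if v ∈ A then a v else if v ∈ B then b v else c v, ?_, ?_, ?_⟩
  · rw [← ha]
    refine Finset.image_congr fun v hv => ?_
    have hv' : v ∈ A := hv
    simp [hv']
  · rw [← hb]
    refine Finset.image_congr fun v hv => ?_
    have hv' : v ∈ B := hv
    grind
  · rw [← hc]
    refine Finset.image_congr fun v hv => ?_
    have hv' : v ∈ C := hv
    grind

theorem exists_inj_into {W X : Type*} [DecidableEq W] [Nonempty X] (S : Finset W) (T : Finset X)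
    (h : S.card ≤ T.card) :
    ∃ f : W → X, (∀ v ∈ S, f v ∈ T) ∧ ∀ v ∈ S, ∀ w ∈ S, f v = f w → v = w := by
  classical
  obtain ⟨f⟩ : Nonempty (S ↪ T) := by
    rw [Function.Embedding.nonempty_iff_card_le]; simpa using h
  refine ⟨fun v => if h : v ∈ S then (f ⟨v, h⟩ : X) else Classical.arbitrary X, ?_, ?_⟩
  · intro v hv; simp [hv]
  · intro v hv w hw hvw
    simp only [hv, hw, dif_pos] at hvw
    simpa using f.injective (Subtype.ext hvw)

set_option maxHeartbeats 1000000 in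
theorem exists_hom_triangle {W X : Type*} [DecidableEq W] [DecidableEq X] [Nonempty X]
    (A B C : Finset W) (P Q R T : Finset X) (r i : ℕ)
    (hA : A.card = r) (hB : B.card = r) (hC : C.card = r)
    (hP : P.card = i) (hQ : Q.card = i) (hR : R.card = i) (hT : T.card + 2 * i = r)
    (hPQ : Disjoint P Q) (hQR : Disjoint Q R) (hRP : Disjoint R P)
    (hPT : Disjoint P T) (hQT : Disjoint Q T) (hRT : Disjoint R T)
    (hcond : 2 * i + (((A ∩ B) \ C).card - i) + (((B ∩ C) \ A).card - i)
      + (((C ∩ A) \ B).card - i) + (A ∩ B ∩ C).card ≤ r) :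
    ∃ χ : W → X, A.image χ = R ∪ P ∪ T ∧ B.image χ = P ∪ Q ∪ T ∧ C.image χ = Q ∪ R ∪ T := by
  obtain ⟨X0, hX0, hX0c⟩ := Finset.exists_subset_card_eq
    (s := (A ∩ B) \ C) (n := min i ((A ∩ B) \ C).card) (min_le_right _ _)
  obtain ⟨Y0, hY0, hY0c⟩ := Finset.exists_subset_card_eq
    (s := (B ∩ C) \ A) (n := min i ((B ∩ C) \ A).card) (min_le_right _ _)
  obtain ⟨Z0, hZ0, hZ0c⟩ := Finset.exists_subset_card_eq
    (s := (C ∩ A) \ B) (n := min i ((C ∩ A) \ B).card) (min_le_right _ _)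
  let K : Finset W := (((A ∩ B) \ C) \ X0) ∪ (((B ∩ C) \ A) \ Y0) ∪ (((C ∩ A) \ B) \ Z0)
    ∪ (A ∩ B ∩ C)
  have hKc : K.card ≤ T.card := by
    have h1 := Finset.card_sdiff_of_subset hX0
    have h2 := Finset.card_sdiff_of_subset hY0
    have h3 := Finset.card_sdiff_of_subset hZ0
    have h4 := Finset.card_union_le ((((A ∩ B) \ C) \ X0) ∪ (((B ∩ C) \ A) \ Y0) ∪
      (((C ∩ A) \ B) \ Z0)) (A ∩ B ∩ C)
    have h5 := Finset.card_union_le ((((A ∩ B) \ C) \ X0) ∪ (((B ∩ C) \ A) \ Y0))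
      (((C ∩ A) \ B) \ Z0)
    have h6 := Finset.card_union_le (((A ∩ B) \ C) \ X0) (((B ∩ C) \ A) \ Y0)
    change ((((A ∩ B) \ C) \ X0) ∪ (((B ∩ C) \ A) \ Y0) ∪ (((C ∩ A) \ B) \ Z0)
      ∪ (A ∩ B ∩ C)).card ≤ _
    omega
  obtain ⟨f1, h1m, h1i⟩ := exists_inj_into X0 P (by omega)
  obtain ⟨f2, h2m, h2i⟩ := exists_inj_into Y0 Q (by omega)
  obtain ⟨f3, h3m, h3i⟩ := exists_inj_into Z0 R (by omega)
  obtain ⟨f4, h4m, h4i⟩ := exists_inj_into K T hKc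
  let f : W → X := fun v => if v ∈ X0 then f1 v else if v ∈ Y0 then f2 v else
    if v ∈ Z0 then f3 v else f4 v
  have hX : ∀ v, v ∈ X0 → (v ∈ A ∧ v ∈ B ∧ v ∉ C) := fun v hv => by
    have := hX0 hv; simp at this; tauto
  have hY : ∀ v, v ∈ Y0 → (v ∈ B ∧ v ∈ C ∧ v ∉ A) := fun v hv => by
    have := hY0 hv; simp at this; tauto
  have hZ : ∀ v, v ∈ Z0 → (v ∈ C ∧ v ∈ A ∧ v ∉ B) := fun v hv => by
    have := hZ0 hv; simp at this; tauto
  have hK : ∀ v, v ∈ K ↔ ((v ∈ A ∧ v ∈ B ∨ v ∈ B ∧ v ∈ C ∨ v ∈ C ∧ v ∈ A) ∧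
      v ∉ X0 ∧ v ∉ Y0 ∧ v ∉ Z0) := by
    intro v
    have a1 := hX v
    have a2 := hY v
    have a3 := hZ v
    simp only [K, Finset.mem_union, Finset.mem_sdiff, Finset.mem_inter]
    clear hX hY hZ h1m h1i h2m h2i h3m h3i h4m h4i hKc hcond hPQ hQR hRP hPT hQT hRT
    grind
  have fX : ∀ v ∈ X0, f v = f1 v := fun v hv => by simp [f, hv]
  have fY : ∀ v ∈ Y0, f v = f2 v := fun v hv => by
    have : v ∉ X0 := fun h => (hY v hv).2.2 (hX v h).1
    simp [f, hv, this]
  have fZ : ∀ v ∈ Z0, f v = f3 v := fun v hv => by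
    have h1 : v ∉ X0 := fun h => (hZ v hv).2.2 (hX v h).2.1
    have h2 : v ∉ Y0 := fun h => (hZ v hv).2.2 (hY v h).1
    simp [f, hv, h1, h2]
  have fK : ∀ v ∈ K, f v = f4 v := fun v hv => by
    obtain ⟨_, h1, h2, h3⟩ := (hK v).1 hv
    simp [f, h1, h2, h3]
  have hD : ∀ v, v ∈ (A ∩ B) ∪ (B ∩ C) ∪ (C ∩ A) →
      v ∈ X0 ∨ v ∈ Y0 ∨ v ∈ Z0 ∨ v ∈ K := by
    intro v hv
    rw [hK]
    simp only [Finset.mem_union, Finset.mem_inter] at hv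
    by_cases a1 : v ∈ X0
    · exact Or.inl a1
    by_cases a2 : v ∈ Y0
    · exact Or.inr (Or.inl a2)
    by_cases a3 : v ∈ Z0
    · exact Or.inr (Or.inr (Or.inl a3))
    exact Or.inr (Or.inr (Or.inr ⟨by tauto, a1, a2, a3⟩))
  clear_value f K
  clear hcond hKc hX0c hY0c hZ0c hX0 hY0 hZ0
  rw [Finset.disjoint_left] at hPQ hQR hRP hPT hQT hRT
  refine glue A B C ((A ∩ B) ∪ (B ∩ C) ∪ (C ∩ A)) _ _ _ ?_ ?_ ?_ ?_ ?_ ?_ f ?_ ?_ ?_ ?_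
  · rw [Finset.card_union_of_disjoint, Finset.card_union_of_disjoint]
    · omega
    · exact Finset.disjoint_left.2 hRP
    · exact Finset.disjoint_union_left.2 ⟨Finset.disjoint_left.2 hRT, Finset.disjoint_left.2 hPT⟩
  · rw [Finset.card_union_of_disjoint, Finset.card_union_of_disjoint]
    · omega
    · exact Finset.disjoint_left.2 hPQ
    · exact Finset.disjoint_union_left.2 ⟨Finset.disjoint_left.2 hPT, Finset.disjoint_left.2 hQT⟩
  · rw [Finset.card_union_of_disjoint, Finset.card_union_of_disjoint]
    · omega
    · exact Finset.disjoint_left.2 hQR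
    · exact Finset.disjoint_union_left.2 ⟨Finset.disjoint_left.2 hQT, Finset.disjoint_left.2 hRT⟩
  · intro v h1 h2; simp [h1, h2]
  · intro v h1 h2; simp [h1, h2]
  · intro v h1 h2; simp [h1, h2]
  · intro v hv w hw hvw
    rcases hD v hv with h | h | h | h <;> rcases hD w hw with h' | h' | h' | h' <;> grind
  · intro v hv hvD
    rcases hD v hvD with h | h | h | h <;> grind
  · intro v hv hvD
    rcases hD v hvD with h | h | h | h <;> grind
  · intro v hv hvD
    rcases hD v hvD with h | h | h | h <;> grind

/-- The lifted parts of the suspended expanded triangle. -/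
def partS (i t a : ℕ) : Finset (Fin (3 * i + t)) :=
  Finset.univ.filter fun v => a * i ≤ v.val ∧ v.val < (a + 1) * i

def partT (i t : ℕ) : Finset (Fin (3 * i + t)) :=
  Finset.univ.filter fun v => 3 * i ≤ v.val

theorem suspend_eq (i t : ℕ) : suspend t (expTriangle i) =
    {partS i t 0 ∪ partS i t 1 ∪ partT i t, partS i t 1 ∪ partS i t 2 ∪ partT i t,
      partS i t 2 ∪ partS i t 0 ∪ partT i t} := by
  have hS : ∀ a < 3, (Finset.univ.filter fun v : Fin (3 * i) =>
      a * i ≤ v.val ∧ v.val < (a + 1) * i).image (Fin.castAdd t) = partS i t a := by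
    intro a ha
    ext v
    simp only [partS, Finset.mem_image, Finset.mem_filter, Finset.mem_univ, true_and]
    constructor
    · rintro ⟨x, hx, rfl⟩; simpa using hx
    · intro hv
      have : (a + 1) * i ≤ 3 * i := Nat.mul_le_mul_right _ (by omega)
      exact ⟨⟨v.1, by omega⟩, hv, rfl⟩
  simp only [suspend, expTriangle, Finset.image_insert, Finset.image_singleton, Finset.image_union]
  rw [hS 0 (by omega), hS 1 (by omega), hS 2 (by omega)]
  rfl

theorem card_partS (i t a : ℕ) (ha : a < 3) : (partS i t a).card = i := by
  have h : (partS i t a).map Fin.valEmbedding = Finset.Ico (a * i) ((a + 1) * i) := by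
    ext x
    have : (a + 1) * i ≤ 3 * i := Nat.mul_le_mul_right _ (by omega)
    simp only [partS, Finset.mem_map, Finset.mem_filter, Finset.mem_univ, true_and,
      Fin.valEmbedding_apply, Finset.mem_Ico]
    constructor
    · rintro ⟨v, hv, rfl⟩; exact hv
    · intro hx; exact ⟨⟨x, by omega⟩, hx, rfl⟩
  rw [← Finset.card_map Fin.valEmbedding, h, Nat.card_Ico, add_mul]
  omega

theorem card_partT (i t : ℕ) : (partT i t).card = t := by
  have h : (partT i t).map Fin.valEmbedding = Finset.Ico (3 * i) (3 * i + t) := by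
    ext x
    simp only [partT, Finset.mem_map, Finset.mem_filter, Finset.mem_univ, true_and,
      Fin.valEmbedding_apply, Finset.mem_Ico]
    constructor
    · rintro ⟨v, hv, rfl⟩; exact ⟨hv, v.2⟩
    · intro hx; exact ⟨⟨x, by omega⟩, hx.1, rfl⟩
  rw [← Finset.card_map Fin.valEmbedding, h, Nat.card_Ico]
  omega

theorem disj_SS (i t a b : ℕ) (hab : a < b) : Disjoint (partS i t a) (partS i t b) := by
  rw [Finset.disjoint_left]
  intro v h1 h2
  simp only [partS, Finset.mem_filter, Finset.mem_univ, true_and] at h1 h2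
  have : (a + 1) * i ≤ b * i := Nat.mul_le_mul_right _ hab
  omega

theorem disj_ST (i t a : ℕ) (ha : a < 3) : Disjoint (partS i t a) (partT i t) := by
  rw [Finset.disjoint_left]
  intro v h1 h2
  simp only [partS, partT, Finset.mem_filter, Finset.mem_univ, true_and] at h1 h2
  have : (a + 1) * i ≤ 3 * i := Nat.mul_le_mul_right _ (by omega)
  omega

theorem card_edge (i t a b : ℕ) (ha : a < 3) (hb : b < 3) (hab : a ≠ b) :
    (partS i t a ∪ partS i t b ∪ partT i t).card = t + 2 * i := by
  have hd : Disjoint (partS i t a) (partS i t b) := by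
    rcases lt_or_gt_of_ne hab with h | h
    · exact disj_SS i t a b h
    · exact (disj_SS i t b a h).symm
  rw [Finset.card_union_of_disjoint, Finset.card_union_of_disjoint hd, card_partS _ _ _ ha,
    card_partS _ _ _ hb, card_partT]
  · omega
  · exact Finset.disjoint_union_left.2 ⟨disj_ST i t a ha, disj_ST i t b hb⟩

theorem suspend_uniform (i t : ℕ) : ∀ e ∈ suspend t (expTriangle i), e.card = t + 2 * i := by
  intro e he
  rw [suspend_eq] at he
  simp only [Finset.mem_insert, Finset.mem_singleton] at he
  rcases he with rfl | rfl | rfl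
  · exact card_edge _ _ _ _ (by omega) (by omega) (by omega)
  · exact card_edge _ _ _ _ (by omega) (by omega) (by omega)
  · exact card_edge _ _ _ _ (by omega) (by omega) (by omega)

theorem suspend_card (i t : ℕ) (hi : 0 < i) : (suspend t (expTriangle i)).card = 3 := by
  rw [suspend_eq, Finset.card_eq_three]
  refine ⟨_, _, _, ?_, ?_, ?_, rfl⟩
  · intro h
    have := Finset.ext_iff.1 h ⟨0, by omega⟩
    simp [partS, partT] at this
    omega
  · intro h
    have := Finset.ext_iff.1 h ⟨i, by omega⟩
    simp [partS, partT] at this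
    omega
  · intro h
    have := Finset.ext_iff.1 h ⟨0, by omega⟩
    simp [partS, partT] at this
    omega

theorem exists_hom {m r : ℕ} (hr : 2 ≤ r) (F : Finset (Finset (Fin m)))
    (hFu : ∀ e ∈ F, e.card = r) (hF : F.card = 3) :
    ∃ i ∈ Finset.Icc 1 (r / 2), ∃ χ : Fin m → Fin (3 * i + (r - 2 * i)),
      ∀ e ∈ F, e.image χ ∈ suspend (r - 2 * i) (expTriangle i) := by
  obtain ⟨A, B, C, hAB, hAC, hBC, rfl⟩ := Finset.card_eq_three.1 hF
  have hA : A.card = r := hFu A (by simp)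
  have hB : B.card = r := hFu B (by simp)
  have hC : C.card = r := hFu C (by simp)
  have lt_of_ne : ∀ U V : Finset (Fin m), U.card = r → V.card = r → U ≠ V →
      (U ∩ V).card < r := by
    intro U V hU hV hne
    rw [← hU]
    refine Finset.card_lt_card ⟨Finset.inter_subset_left, fun h => hne ?_⟩
    exact Finset.eq_of_subset_of_card_le (fun v hv => (Finset.mem_inter.1 (h hv)).2) (by omega)
  have hab := lt_of_ne A B hA hB hAB
  have hbc := lt_of_ne B C hB hC hBC
  have hca := lt_of_ne C A hC hA hAC.symm
  -- sizes of the regions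
  have sx := Finset.card_sdiff_add_card_inter (A ∩ B) C
  have sy := Finset.card_sdiff_add_card_inter (B ∩ C) A
  have sz := Finset.card_sdiff_add_card_inter (C ∩ A) B
  have e1 : B ∩ C ∩ A = A ∩ B ∩ C := by ext; simp; tauto
  have e2 : C ∩ A ∩ B = A ∩ B ∩ C := by ext; simp; tauto
  rw [e1] at sy
  rw [e2] at sz
  have pair : ∀ U V Z : Finset (Fin m), V.card = r →
      ((U ∩ V) \ Z).card + ((V ∩ Z) \ U).card + (U ∩ V ∩ Z).card ≤ r := by
    intro U V Z hV
    rw [← hV, ← Finset.card_union_of_disjoint, ← Finset.card_union_of_disjoint]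
    · refine Finset.card_le_card fun v hv => ?_
      simp at hv; tauto
    · rw [Finset.disjoint_left]; intro v hv; simp at hv ⊢; tauto
    · rw [Finset.disjoint_left]; intro v hv; simp at hv ⊢; tauto
  have pB := pair A B C hB
  have pC := pair B C A hC
  have pA := pair C A B hA
  rw [e1] at pC
  rw [e2] at pA
  by_cases hs : (A ∩ B ∩ C).card + 1 = r
  · -- sunflower with kernel of size `r - 1`
    refine ⟨1, by simp; omega, ?_⟩
    set t := r - 2 * 1 with ht
    let E := partS 1 t 0 ∪ partS 1 t 1 ∪ partT 1 t
    have hE : E.card = r := by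
      rw [card_edge _ _ _ _ (by omega) (by omega) (by omega)]; omega
    have hsub : ∀ U V : Finset (Fin m), A ∩ B ∩ C ⊆ U ∩ V → (U ∩ V).card < r →
        ∀ v ∈ U, v ∈ V → v ∈ A ∩ B ∩ C := by
      intro U V h hc v hU hV
      rw [Finset.eq_of_subset_of_card_le h (by omega)]
      exact Finset.mem_inter.2 ⟨hU, hV⟩
    have hne : Nonempty (Fin (3 * 1 + t)) := ⟨⟨0, by omega⟩⟩
    obtain ⟨f, hfm, hfi⟩ := exists_inj_into (A ∩ B ∩ C) E (by omega)
    obtain ⟨χ, h1, h2, h3⟩ := glue A B C (A ∩ B ∩ C) E E E (by omega) (by omega) (by omega)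
      (hsub A B (fun v hv => by simp at hv ⊢; tauto) hab)
      (hsub B C (fun v hv => by simp at hv ⊢; tauto) hbc)
      (hsub C A (fun v hv => by simp at hv ⊢; tauto) hca) f hfi
      (fun v _ h => hfm v h) (fun v _ h => hfm v h) (fun v _ h => hfm v h)
    refine ⟨χ, fun e he => ?_⟩
    have hmem : E ∈ suspend t (expTriangle 1) := by rw [suspend_eq]; simp [E]
    simp only [Finset.mem_insert, Finset.mem_singleton] at he
    rcases he with rfl | rfl | rfl
    · rw [h1]; exact hmem
    · rw [h2]; exact hmem
    · rw [h3]; exact hmem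
  · obtain ⟨i, hi1, hi2⟩ : ∃ i, 1 ≤ i ∧ 2 * i + (((A ∩ B) \ C).card - i) +
        (((B ∩ C) \ A).card - i) + (((C ∩ A) \ B).card - i) + (A ∩ B ∩ C).card ≤ r := by
      generalize ((A ∩ B) \ C).card = x at *
      generalize ((B ∩ C) \ A).card = y at *
      generalize ((C ∩ A) \ B).card = z at *
      generalize (A ∩ B ∩ C).card = d at *
      refine ⟨max 1 (max (min x y) (max (min y z) (min z x))), by omega, by omega⟩
    refine ⟨i, by simp; omega, ?_⟩
    set t := r - 2 * i with ht
    have hne : Nonempty (Fin (3 * i + t)) := ⟨⟨0, by omega⟩⟩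
    obtain ⟨χ, h1, h2, h3⟩ := exists_hom_triangle A B C (partS i t 0) (partS i t 1) (partS i t 2)
      (partT i t) r i hA hB hC (card_partS _ _ _ (by omega)) (card_partS _ _ _ (by omega))
      (card_partS _ _ _ (by omega)) (by rw [card_partT]; omega)
      (disj_SS _ _ _ _ (by omega)) (disj_SS _ _ _ _ (by omega)) (disj_SS _ _ _ _ (by omega)).symm
      (disj_ST _ _ _ (by omega)) (disj_ST _ _ _ (by omega)) (disj_ST _ _ _ (by omega)) hi2
    refine ⟨χ, fun e he => ?_⟩
    rw [suspend_eq]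
    simp only [Finset.mem_insert, Finset.mem_singleton] at he
    rcases he with rfl | rfl | rfl
    · rw [h1]; simp
    · rw [h2]; simp
    · rw [h3]; simp

/-- For every `r ≥ 2`, `γ(r)` equals the maximum of `π(T̂_{2i}^r)` over
`1 ≤ i ≤ ⌊r/2⌋`. -/
theorem gammaT_eq_max_susp (r : ℕ) (hr : 2 ≤ r) :
    gammaT r = (Finset.Icc 1 (r / 2)).sup' (Finset.nonempty_Icc.mpr (by omega))
      (fun i => turanDensity r (suspend (r - 2 * i) (expTriangle i))) := by
  have hbound : ∀ x ∈ {x : ℝ | ∃ (m : ℕ) (F : Finset (Finset (Fin m))),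
      (∀ e ∈ F, e.card = r) ∧ F.card = 3 ∧ turanDensity r F = x},
      x ≤ (Finset.Icc 1 (r / 2)).sup' (Finset.nonempty_Icc.mpr (by omega))
        (fun i => turanDensity r (suspend (r - 2 * i) (expTriangle i))) := by
    rintro x ⟨m, F, hFu, hF, rfl⟩
    obtain ⟨i, hi, χ, hχ⟩ := exists_hom hr F hFu hF
    have hi' := Finset.mem_Icc.1 hi
    have hGu : ∀ e ∈ suspend (r - 2 * i) (expTriangle i), e.card = r := by
      intro e he
      rw [suspend_uniform i _ e he]; omega
    exact (turanDensity_le_of_hom (by omega) hFu hGu χ hχ).trans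
      (Finset.le_sup' (fun i => turanDensity r (suspend (r - 2 * i) (expTriangle i))) hi)
  have hmem : ∀ i ∈ Finset.Icc 1 (r / 2),
      turanDensity r (suspend (r - 2 * i) (expTriangle i)) ∈
        {x : ℝ | ∃ (m : ℕ) (F : Finset (Finset (Fin m))),
          (∀ e ∈ F, e.card = r) ∧ F.card = 3 ∧ turanDensity r F = x} := by
    intro i hi
    have hi' := Finset.mem_Icc.1 hi
    refine ⟨_, _, fun e he => ?_, suspend_card i _ (by omega), rfl⟩
    rw [suspend_uniform i _ e he]; omega
  unfold gammaT
  apply le_antisymm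
  · exact csSup_le ⟨_, hmem 1 (Finset.mem_Icc.2 ⟨le_rfl, by omega⟩)⟩ hbound
  · exact Finset.sup'_le _ _ fun i hi => le_csSup ⟨_, hbound⟩ (hmem i hi)
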